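/- Let m ≥ 1, let u ∈ ℝᵐ, and set t = |u|². Then the determinant of the 2m×2m block matrix G = [[μ((α₁+α₃)(t),(β₁+β₃)(t),u), μ(α₂(t),β₂(t),u)], [μ(α₂(t),β₂(t),u), μ(α₁(t),β₁(t),u)]] equals α(t)^{m−1}·φ(t); in particular, for m ≥ 2 the matrix G is invertible if and only if α(t)·φ(t) ≠ 0. -/

import Mathlib

open Matrix

/-- The `m × m` real matrix with `(i,j)` entry `a·δᵢⱼ + b·uⁱuʲ`. -/
def mu {m : ℕ} (a b : ℝ) (u : Fin m → ℝ) : Matrix (Fin m) (Fin m) ℝ :=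
  Matrix.of fun i j => a * (if i = j then (1 : ℝ) else 0) + b * u i * u j

open Polynomial in
/-- The determinant of a block matrix with square blocks, the lower two of which commute. -/
theorem det_fromBlocks_of_commute {n R : Type*} [Fintype n] [DecidableEq n] [CommRing R]
    (A B C D : Matrix n n R) (h : Commute C D) :
    (fromBlocks A B C D).det = (A * D - B * C).det := by
  have key : ∀ {S : Type _} [CommRing S] (A B C D : Matrix n n S), Commute C D →
      (fromBlocks A B C D).det * D.det = (A * D - B * C).det * D.det := by
    intro S _ A B C D h
    have hmul : fromBlocks A B C D * fromBlocks D 0 (-C) 1 =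
        fromBlocks (A * D - B * C) B 0 D := by
      simp [fromBlocks_multiply, h.eq, sub_eq_add_neg]
    simpa using congrArg Matrix.det hmul
  set D' : Matrix n n R[X] := (X : R[X]) • 1 + D.map Polynomial.C with hD'
  have hcomm : Commute (C.map Polynomial.C) D' := by
    refine Commute.add_right (Commute.smul_right (Commute.one_right _) _) ?_
    exact h.map (Polynomial.C.mapMatrix (m := n))
  have hreg : IsRightRegular D'.det :=
    (show D'.det.Monic from leadingCoeff_det_X_one_add_C D).isRegular.right
  have hdet := hreg (key (A.map Polynomial.C) (B.map Polynomial.C) _ D' hcomm)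
  have hev : ∀ M : Matrix n n R, (evalRingHom (0 : R)).mapMatrix (M.map Polynomial.C) = M := by
    intro M
    ext i j
    simp
  have hevD : (evalRingHom (0 : R)).mapMatrix D' = D := by
    ext i j
    simp [hD', Matrix.smul_apply]
  have hblocks : (evalRingHom (0 : R)).mapMatrix (fromBlocks (A.map Polynomial.C)
      (B.map Polynomial.C) (C.map Polynomial.C) D') = fromBlocks A B C D := by
    rw [RingHom.mapMatrix_apply, fromBlocks_map]
    exact fromBlocks_inj.2 ⟨hev A, hev B, hev C, hevD⟩
  have := congrArg (evalRingHom (0 : R)) hdet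
  rwa [RingHom.map_det, RingHom.map_det, hblocks, map_sub, map_mul, map_mul, hev, hev, hev,
    hevD] at this

theorem mu_eq_scalar_sub_vecMulVec {m : ℕ} (a b : ℝ) (u : Fin m → ℝ) :
    mu a b u = Matrix.scalar (Fin m) a - vecMulVec (-b • u) u := by
  ext i j
  simp [mu, vecMulVec_apply, Matrix.diagonal_apply, mul_assoc]

theorem det_mu {m : ℕ} (hm : 1 ≤ m) (a b : ℝ) (u : Fin m → ℝ) :
    (mu a b u).det = a ^ (m - 1) * (a + (∑ i, u i ^ 2) * b) := by
  rw [mu_eq_scalar_sub_vecMulVec, ← eval_charpoly, charpoly_vecMulVec]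
  obtain ⟨k, rfl⟩ := Nat.exists_eq_add_of_le' hm
  have h : (-b • u) ⬝ᵥ u = -b * ∑ i, u i ^ 2 := by
    rw [smul_dotProduct]
    simp only [dotProduct, smul_eq_mul, ← pow_two]
  simp [h, -smul_dotProduct, -neg_smul]
  ring

theorem mu_mul_mu {m : ℕ} (a b c d : ℝ) (u : Fin m → ℝ) :
    mu a b u * mu c d u = mu (a * c) (a * d + b * c + b * d * ∑ i, u i ^ 2) u := by
  ext i j
  have h : ∑ k, b * u i * u k * (d * u k * u j) = b * d * (∑ k, u k ^ 2) * u i * u j := by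
    simp only [Finset.mul_sum, Finset.sum_mul]
    exact Finset.sum_congr rfl fun k _ => by ring
  simp only [mu, Matrix.mul_apply, of_apply, add_mul, mul_add, Finset.sum_add_distrib, h]
  simp
  split_ifs <;> ring

theorem mu_sub_mu {m : ℕ} (a b c d : ℝ) (u : Fin m → ℝ) :
    mu a b u - mu c d u = mu (a - c) (b - d) u := by
  ext i j
  simp only [mu, Matrix.sub_apply, of_apply]
  ring

theorem commute_mu {m : ℕ} (a b c d : ℝ) (u : Fin m → ℝ) :
    Commute (mu a b u) (mu c d u) := by
  rw [Commute, SemiconjBy, mu_mul_mu, mu_mul_mu]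
  congr 1 <;> ring

theorem stmt17 (m : ℕ) (hm : 1 ≤ m) (α₁ α₂ α₃ β₁ β₂ β₃ : ℝ → ℝ)
    (u : Fin m → ℝ) (t : ℝ) (ht : t = ∑ i, u i ^ 2)
    (φ₁ φ₂ φ₃ A Φ : ℝ)
    (hφ₁ : φ₁ = α₁ t + t * β₁ t) (hφ₂ : φ₂ = α₂ t + t * β₂ t)
    (hφ₃ : φ₃ = α₃ t + t * β₃ t)
    (hA : A = α₁ t * (α₁ t + α₃ t) - α₂ t ^ 2)
    (hΦ : Φ = φ₁ * (φ₁ + φ₃) - φ₂ ^ 2)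
    (G : Matrix (Fin m ⊕ Fin m) (Fin m ⊕ Fin m) ℝ)
    (hG : G = Matrix.fromBlocks
      (mu (α₁ t + α₃ t) (β₁ t + β₃ t) u) (mu (α₂ t) (β₂ t) u)
      (mu (α₂ t) (β₂ t) u) (mu (α₁ t) (β₁ t) u)) :
    G.det = A ^ (m - 1) * Φ ∧ (2 ≤ m → (IsUnit G ↔ A * Φ ≠ 0)) := by
  have hdet : G.det = A ^ (m - 1) * Φ := by
    rw [hG, det_fromBlocks_of_commute _ _ _ _ (commute_mu _ _ _ _ _), mu_mul_mu, mu_mul_mu,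
      mu_sub_mu, det_mu hm, ← ht, hΦ, hφ₁, hφ₂, hφ₃, hA]
    ring
  refine ⟨hdet, fun h2 => ?_⟩
  rw [Matrix.isUnit_iff_isUnit_det, isUnit_iff_ne_zero, hdet, mul_ne_zero_iff, mul_ne_zero_iff,
    pow_ne_zero_iff (by lia)]
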